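/- Let (X, ρ, μ) be a geodesic coarse median space of rank at most η, with parameters K, H and constants λ₀, γ as stated, and set L₁(r) = (K+1)r + Kλ₀ + γ + 2H(0), L₂(r,κ) = (K+1)r + κ + H(0), L₃(r,t) = 3^η K^η r t + r. Then for every κ > 0 and every t > 0 there exists r_t > 0 such that for all r ≥ r_t and all a, b ∈ X there exists h ∈ [a,b]_{L₁(r)} with ρ(a,h) ≤ L₃(r,t) and B(a, rt) ∩ [a,b]_κ ⊆ [a,h]_{L₂(r,κ)}. -/

import Mathlib

open scoped ENNReal

namespace CoarseMedian

/-- A ternary operation is a median-algebra operation if it satisfies the median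
axioms M1 (absorption), M2 (symmetry) and M3 (the median law). -/
def IsMedianAlgOp {M : Type*} (m : M → M → M → M) : Prop :=
  (∀ x y : M, m x x y = x) ∧
  (∀ x y z : M, m x y z = m x z y ∧ m x y z = m y x z ∧ m x y z = m y z x ∧
    m x y z = m z x y ∧ m x y z = m z y x) ∧
  (∀ x y z u v : M, m (m x y z) u v = m (m x u v) (m y u v) z)

/-- The coordinatewise majority median on the discrete cube `{0,1}^d`. -/
def majCube (d : ℕ) (a b c : Fin d → Bool) : Fin d → Bool :=
  fun i => (a i && b i) || (b i && c i) || (a i && c i)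

/-- A median-algebra operation has rank at most `η` if the algebra admits no injective
median-preserving map from the cube `{0,1}^{η+1}` with its majority median. -/
def OpRankLE {M : Type*} (m : M → M → M → M) (η : ℕ) : Prop :=
  ¬ ∃ f : (Fin (η + 1) → Bool) → M, Function.Injective f ∧
      ∀ a b c : Fin (η + 1) → Bool, f (majCube (η + 1) a b c) = m (f a) (f b) (f c)

/-- `μ` is a coarse median of rank at most `η` on the space with distance function `ρ`,
with parameters `K` and `H`: the axioms M1, M2, the coarse Lipschitz condition (C1) with
constants `K, H(0)`, and the finite approximation condition (C2) by finite median
algebras of rank at most `η`, with control function `H`. -/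
def IsCoarseMedianRank {X : Type*} (ρ : X → X → ℝ) (μ : X → X → X → X)
    (K : ℝ) (H : ℕ → ℝ) (η : ℕ) : Prop :=
  (∀ a b : X, μ a a b = a) ∧
  (∀ a b c : X, μ a b c = μ a c b ∧ μ a b c = μ b a c ∧ μ a b c = μ b c a ∧
    μ a b c = μ c a b ∧ μ a b c = μ c b a) ∧
  (∀ a b c a' b' c' : X,
    ρ (μ a b c) (μ a' b' c') ≤ K * (ρ a a' + ρ b b' + ρ c c') + H 0) ∧
  (∀ p : ℕ, 1 ≤ p → ∀ A : Finset X, A.Nonempty → A.card ≤ p →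
    ∃ (M : Type) (_ : Fintype M) (m : M → M → M → M),
      IsMedianAlgOp m ∧ OpRankLE m η ∧
      ∃ (π : X → M) (lam : M → X),
        (∀ x y z : M, ρ (lam (m x y z)) (μ (lam x) (lam y) (lam z)) ≤ H p) ∧
        (∀ a ∈ A, ρ a (lam (π a)) ≤ H p))

end CoarseMedian

open CoarseMedian

/-- A metric space is geodesic if any two points are joined by an isometric embedding
of a closed real interval with those points as images of the endpoints. -/
def IsGeodesicSpace (X : Type*) [MetricSpace X] : Prop :=
  ∀ x y : X, ∃ f : ℝ → X, f 0 = x ∧ f (dist x y) = y ∧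
    ∀ s ∈ Set.Icc (0 : ℝ) (dist x y), ∀ t ∈ Set.Icc (0 : ℝ) (dist x y),
      dist (f s) (f t) = |s - t|

/-- The coarse interval `[a,b]_r`: the set of `z` with `dist (μ a b z) z ≤ r`. -/
def coarseInterval {X : Type*} [MetricSpace X] (μ : X → X → X → X) (a b : X) (r : ℝ) :
    Set X :=
  {z | dist (μ a b z) z ≤ r}

/-! ### The lattice structure on an interval of a median algebra -/

section MedAlg

variable {M : Type} {m : M → M → M → M}

lemma med_swap12 (hm : IsMedianAlgOp m) (x y z : M) : m x y z = m y x z := (hm.2.1 x y z).2.1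
lemma med_swap23 (hm : IsMedianAlgOp m) (x y z : M) : m x y z = m x z y := (hm.2.1 x y z).1
lemma med_rot (hm : IsMedianAlgOp m) (x y z : M) : m x y z = m y z x := (hm.2.1 x y z).2.2.1
lemma med_rot2 (hm : IsMedianAlgOp m) (x y z : M) : m x y z = m z x y := (hm.2.1 x y z).2.2.2.1
lemma med_rev (hm : IsMedianAlgOp m) (x y z : M) : m x y z = m z y x := (hm.2.1 x y z).2.2.2.2

lemma med_assoc_aux (hm : IsMedianAlgOp m) (x y z c : M) :
    m (m x y c) z c = m x (m y z c) c := by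
  have h := hm.2.2 y c x c z
  rw [hm.1] at h
  rw [med_rot hm x y c, med_swap23 hm (m y c x) z c, h, med_rot hm x (m y z c) c,
    med_swap23 hm y z c]

lemma med_proj_mem (hm : IsMedianAlgOp m) (α β w : M) : m α β (m α β w) = m α β w := by
  have h := hm.2.2 α β w α β
  rw [hm.1, med_swap12 hm β α β, med_swap23 hm α β β, med_rot hm α β β, hm.1] at h
  rw [← med_rot hm (m α β w) α β, h]

lemma med_absorb (hm : IsMedianAlgOp m) {α β x : M} (hx : m α β x = x) (y : M) :
    m x (m x y α) β = x := by
  have h := hm.2.2 α y x x β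
  rw [med_swap23 hm α x β, hx, med_swap23 hm x _ x, hm.1] at h
  rw [med_swap12 hm x _ β, med_rot2 hm x y α, med_swap23 hm α x y, h]

lemma med_inf_mem (hm : IsMedianAlgOp m) {α β x : M} (hx : m α β x = x) (y : M) :
    m α β (m x y α) = m x y α := by
  have h := hm.2.2 x α y α β
  rw [hm.1, med_rot hm x α β, hx] at h
  rw [← med_rot hm (m x y α) α β, med_swap23 hm x y α, h]

@[reducible]
def intLattice (hm : IsMedianAlgOp m) (α β : M) : DistribLattice {x // m α β x = x} :=
  letI i1 : Max {x // m α β x = x} := ⟨fun x y => ⟨m x.1 y.1 β, by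
    have h1 : m β α x.1 = x.1 := by rw [med_swap12 hm, x.2]
    have := med_inf_mem hm h1 y.1
    rw [med_swap12 hm, this]⟩⟩
  letI i2 : Min {x // m α β x = x} := ⟨fun x y => ⟨m x.1 y.1 α, med_inf_mem hm x.2 y.1⟩⟩
  letI : Lattice {x // m α β x = x} := Lattice.mk'
    (fun x y => Subtype.ext (med_swap12 hm _ _ _))
    (fun x y z => Subtype.ext (med_assoc_aux hm _ _ _ _))
    (fun x y => Subtype.ext (med_swap12 hm _ _ _))
    (fun x y z => Subtype.ext (med_assoc_aux hm _ _ _ _))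
    (fun x y => Subtype.ext (med_absorb hm x.2 _))
    (fun x y => Subtype.ext (by
      have h1 : m β α x.1 = x.1 := by rw [med_swap12 hm, x.2]
      exact med_absorb hm h1 _))
  DistribLattice.mk (fun x y z => by
    apply le_of_eq
    apply Subtype.ext
    change m (m x.1 y.1 β) (m x.1 z.1 β) α = m x.1 (m y.1 z.1 α) β
    rw [med_swap12 hm x.1 (m y.1 z.1 α) β, hm.2.2 y.1 z.1 α x.1 β, med_swap12 hm x.1 y.1 β,
      med_swap12 hm x.1 z.1 β])

lemma intLattice_sup (hm : IsMedianAlgOp m) (α β : M) (x y : {x // m α β x = x}) :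
    letI := intLattice hm α β
    ((x ⊔ y : {x // m α β x = x}) : M) = m x.1 y.1 β := rfl

lemma intLattice_inf (hm : IsMedianAlgOp m) (α β : M) (x y : {x // m α β x = x}) :
    letI := intLattice hm α β
    ((x ⊓ y : {x // m α β x = x}) : M) = m x.1 y.1 α := rfl

@[reducible]
def intBounded (hm : IsMedianAlgOp m) (α β : M) :
    letI := intLattice hm α β
    BoundedOrder {x // m α β x = x} :=
  letI := intLattice hm α β
  { top := ⟨β, by rw [med_rot hm, hm.1]⟩
    bot := ⟨α, by rw [med_swap23 hm, hm.1]⟩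
    le_top := fun x => sup_eq_right.1 (Subtype.ext (by
      rw [intLattice_sup, med_rev hm, hm.1]))
    bot_le := fun x => inf_eq_left.1 (Subtype.ext (by
      rw [intLattice_inf, med_swap23 hm, hm.1])) }

lemma med_inf_le (hm : IsMedianAlgOp m) (c x y z : M) :
    m (m x y c) (m x y z) c = m x y c := by
  have h := hm.2.2 c z c x y
  rw [med_swap23 hm c z c, hm.1, med_rot hm c x y, med_rot hm z x y] at h
  exact h.symm

lemma med_mem (hm : IsMedianAlgOp m) {α β x y z : M} (hx : m α β x = x) (hy : m α β y = y)
    : m α β (m x y z) = m x y z := by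
  have h := hm.2.2 x y z α β
  rw [med_rot hm x α β, med_rot hm y α β, hx, hy, med_rot hm _ α β] at h
  exact h

/-- The median of three points of the interval is the lattice median. -/
lemma intLattice_med (hm : IsMedianAlgOp m) (α β : M) (x y z : {x // m α β x = x}) :
    letI := intLattice hm α β
    ((x ⊓ y ⊔ y ⊓ z ⊔ x ⊓ z : {x // m α β x = x}) : M) = m x.1 y.1 z.1 := by
  letI := intLattice hm α β
  set t : {x // m α β x = x} := ⟨m x.1 y.1 z.1, med_mem hm x.2 y.2⟩ with ht
  have hxy : ∀ (u v w : {x // m α β x = x}), m u.1 v.1 w.1 = m x.1 y.1 z.1 →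
      u ⊓ v ≤ t ∧ t ≤ u ⊔ v := by
    intro u v w h
    constructor
    · apply inf_eq_left.1
      apply Subtype.ext
      rw [intLattice_inf, intLattice_inf, ht]
      simp only
      rw [← h]
      exact med_inf_le hm _ _ _ _
    · apply sup_eq_right.1
      rw [sup_comm]
      have h3 : (u ⊔ v) ⊔ t = u ⊔ v := by
        apply Subtype.ext
        rw [intLattice_sup, intLattice_sup, ht]
        simp only
        rw [← h]
        exact med_inf_le hm _ _ _ _
      rw [sup_comm]
      exact sup_comm t (u ⊔ v) ▸ h3
  obtain ⟨a1, b1⟩ := hxy x y z rfl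
  obtain ⟨a2, b2⟩ := hxy y z x (med_rot hm _ _ _).symm
  obtain ⟨a3, b3⟩ := hxy x z y (med_swap23 hm _ _ _).symm
  have key : x ⊓ y ⊔ y ⊓ z ⊔ x ⊓ z = t := by
    apply le_antisymm
    · exact sup_le (sup_le a1 a2) a3
    · calc t ≤ (x ⊔ y) ⊓ (y ⊔ z) ⊓ (x ⊔ z) := le_inf (le_inf b1 b2) b3
        _ ≤ x ⊓ y ⊔ y ⊓ z ⊔ x ⊓ z := by
          have e : (x ⊔ y) ⊓ (y ⊔ z) = y ⊔ x ⊓ z := by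
            rw [sup_comm x y, ← sup_inf_left]
          rw [e, inf_sup_right, inf_sup_left]
          refine sup_le (sup_le ?_ ?_) ?_
          · rw [inf_comm]
            exact le_sup_of_le_left le_sup_left
          · exact le_sup_of_le_left le_sup_right
          · exact le_sup_of_le_right inf_le_left
  rw [key]

/-- Lattice form of the rank condition: no `η + 1` elements form an irredundant join. -/
def LatRank (L : Type*) [DistribLattice L] [BoundedOrder L] (η : ℕ) : Prop :=
  ¬ ∃ x : Fin (η + 1) → L, ∀ k, ¬ x k ≤ (Finset.univ.erase k).sup x

lemma intLattice_rank (hm : IsMedianAlgOp m) (α β : M) {η : ℕ} (hr : OpRankLE m η) :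
    letI := intLattice hm α β
    letI := intBounded hm α β
    LatRank {x // m α β x = x} η := by
  letI := intLattice hm α β
  letI := intBounded hm α β
  rintro ⟨x, hx⟩
  apply hr
  set s := Finset.univ.sup x with hs
  set c : Fin (η + 1) → {x // m α β x = x} := fun k => (Finset.univ.erase k).sup x with hc
  have hcs : ∀ k, c k ≤ s := fun k => Finset.sup_mono (Finset.erase_subset _ _)
  have hxs : ∀ k, x k ≤ s := fun k => Finset.le_sup (Finset.mem_univ k)
  have hne : ∀ k, ¬ s ≤ c k := fun k h => hx k ((hxs k).trans h)
  have hcc : ∀ i j, i ≠ j → s ≤ c i ⊔ c j := by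
    intro i j hij
    apply Finset.sup_le
    intro k _
    by_cases hk : k = i
    · apply le_sup_of_le_right
      exact Finset.le_sup (f := x) (Finset.mem_erase.2 ⟨by rw [hk]; exact hij, Finset.mem_univ _⟩)
    · apply le_sup_of_le_left
      exact Finset.le_sup (f := x) (Finset.mem_erase.2 ⟨hk, Finset.mem_univ _⟩)
  set f : (Fin (η + 1) → Bool) → {x // m α β x = x} := fun S =>
    s ⊓ (Finset.univ.filter (fun i => S i = false)).inf c with hf
  have fle : ∀ S i, S i = false → f S ≤ c i := fun S i h =>
    inf_le_of_right_le (Finset.inf_le (by simp [h]))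
  have lef : ∀ S y, y ≤ s → (∀ i, S i = false → y ≤ c i) → y ≤ f S := fun S y h1 h2 =>
    le_inf h1 (Finset.le_inf (fun i hi => h2 i (by simpa using hi)))
  have fs : ∀ S, f S ≤ s := fun S => inf_le_left
  have hinf : ∀ S T, f (fun i => S i && T i) = f S ⊓ f T := by
    intro S T
    apply le_antisymm
    · apply le_inf
      · exact lef _ _ (fs _) (fun i hi => fle _ _ (by simp [hi]))
      · exact lef _ _ (fs _) (fun i hi => fle _ _ (by simp [hi]))
    · apply lef _ _ (inf_le_of_left_le (fs _))
      intro i hi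
      rcases Bool.and_eq_false_iff.1 hi with h | h
      · exact inf_le_of_left_le (fle _ _ h)
      · exact inf_le_of_right_le (fle _ _ h)
  have hsup : ∀ S T, f (fun i => S i || T i) = f S ⊔ f T := by
    intro S T
    apply le_antisymm
    · simp only [hf]
      rw [← inf_sup_left, Finset.inf_sup_inf]
      apply le_inf inf_le_left
      apply Finset.le_inf
      rintro ⟨i, j⟩ hij
      simp only [Finset.mem_product, Finset.mem_filter, Finset.mem_univ, true_and] at hij
      by_cases h : i = j
      · subst h
        apply inf_le_of_right_le
        apply le_sup_of_le_left
        exact Finset.inf_le (by simp [hij.1, hij.2])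
      · exact inf_le_of_left_le (hcc i j h)
    · apply sup_le
      · exact lef _ _ (fs _) (fun i hi => fle _ _ (by simp at hi; simp [hi]))
      · exact lef _ _ (fs _) (fun i hi => fle _ _ (by simp at hi; simp [hi]))
  have hinj : ∀ S T, f S = f T → ∀ i, S i = true → T i = true := by
    intro S T h i hi
    by_contra hT
    have hT' : T i = false := by simpa using hT
    have h1 : f S ≤ c i := h ▸ fle T i hT'
    have h2 : s ≤ f S ⊔ c i := by
      have : f S ⊔ c i = (s ⊔ c i) ⊓ ((Finset.univ.filter (fun i => S i = false)).inf c ⊔ c i) := by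
        simp only [hf]; rw [sup_inf_right]
      rw [this, Finset.inf_sup_distrib_right]
      refine le_inf le_sup_left (Finset.le_inf ?_)
      intro j hj
      apply hcc
      rintro rfl
      simp [hi] at hj
    exact hne i (h2.trans (sup_le h1 le_rfl))
  refine ⟨fun S => (f S).1, ?_, ?_⟩
  · intro S T h
    have h' : f S = f T := Subtype.ext h
    funext i
    rw [Bool.eq_iff_iff]
    exact ⟨hinj S T h' i, hinj T S h'.symm i⟩
  · intro a b c
    have h1 := intLattice_med hm α β (f a) (f b) (f c)
    rw [← h1, ← hinf, ← hinf, ← hinf, ← hsup, ← hsup]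
    rfl

end MedAlg

/-! ### Combinatorics of distributive lattices of bounded rank -/

lemma cells_card (A B : ℕ) : ∀ (n : ℕ) (S : Finset (ℕ × ℕ)),
    (∀ c ∈ S, c.1 < A ∧ c.2 < B) →
    (¬ ∃ c : Fin (n + 1) → ℕ × ℕ, (∀ k, c k ∈ S) ∧
      ∀ k l, k < l → (c k).1 < (c l).1 ∧ (c l).2 < (c k).2) →
    S.card ≤ n * (A + B) := by
  intro n
  induction n with
  | zero =>
    intro S _ h
    rw [Nat.zero_mul, Nat.le_zero, Finset.card_eq_zero]
    by_contra hS
    obtain ⟨c, hc⟩ := Finset.nonempty_iff_ne_empty.2 hS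
    refine h ⟨fun _ => c, fun _ => hc, ?_⟩
    intro k l hkl
    omega
  | succ n ih =>
    intro S hS h
    classical
    set S' := S.filter (fun c => ∃ c' ∈ S, c'.1 < c.1 ∧ c.2 < c'.2) with hS'
    have h1 : S'.card ≤ n * (A + B) := by
      apply ih S' (fun c hc => hS c (Finset.mem_filter.1 hc).1)
      rintro ⟨c, hc, hc2⟩
      obtain ⟨c', hc', h3⟩ := (Finset.mem_filter.1 (hc 0)).2
      apply h
      refine ⟨Fin.cons c' c, ?_, ?_⟩
      · intro k
        refine Fin.cases ?_ (fun k => ?_) k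
        · simpa using hc'
        · simpa using (Finset.mem_filter.1 (hc k)).1
      · intro k l
        refine Fin.cases ?_ (fun k => ?_) k
        · refine Fin.cases ?_ (fun l => ?_) l
          · intro hh; exact absurd hh (lt_irrefl _)
          · intro _
            simp only [Fin.cons_zero, Fin.cons_succ]
            rcases eq_or_ne l 0 with rfl | hl
            · exact h3
            · have := hc2 0 l (Fin.pos_iff_ne_zero.2 hl)
              omega
        · refine Fin.cases ?_ (fun l => ?_) l
          · intro hh; exact absurd hh (by simp)
          · intro hh
            simp only [Fin.cons_succ]
            exact hc2 k l (by simpa using hh)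
    have h2 : (S.filter (fun c => ¬ ∃ c' ∈ S, c'.1 < c.1 ∧ c.2 < c'.2)).card ≤ A + B := by
      rw [← Finset.card_range (A + B)]
      apply Finset.card_le_card_of_injOn (fun c => c.1 + c.2)
      · intro c hc
        have := hS c (Finset.mem_filter.1 hc).1
        simp only [Finset.coe_range, Set.mem_Iio]
        omega
      · intro c hc d hd hcd
        obtain ⟨c1, c2⟩ := Finset.mem_filter.1 hc
        obtain ⟨d1, d2⟩ := Finset.mem_filter.1 hd
        have e1 : ¬ (c.1 < d.1 ∧ d.2 < c.2) := fun hh => d2 ⟨c, c1, hh⟩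
        have e2 : ¬ (d.1 < c.1 ∧ c.2 < d.2) := fun hh => c2 ⟨d, d1, hh⟩
        simp only at hcd
        ext <;> omega
    have h3 := Finset.card_filter_add_card_filter_not (s := S)
      (fun c => ∃ c' ∈ S, c'.1 < c.1 ∧ c.2 < c'.2)
    rw [← h3, Nat.succ_mul]
    exact Nat.add_le_add h1 h2

section Lat

variable {L : Type*} [DistribLattice L] [BoundedOrder L] {η : ℕ}

lemma exists_small_sup (hR : LatRank L η) (z : ℕ → L) (s : Finset ℕ) :
    ∃ u ⊆ s, u.card ≤ η ∧ u.sup z = s.sup z := by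
  classical
  induction hn : s.card using Nat.strong_induction_on generalizing s with
  | _ n ih =>
    by_cases hs : s.card ≤ η
    · exact ⟨s, subset_rfl, hs, rfl⟩
    · push Not at hs
      obtain ⟨u, hus, huc⟩ := Finset.exists_subset_card_eq (Nat.succ_le_of_lt hs)
      let e := u.equivFinOfCardEq huc
      have h1 : ∃ k : Fin (η + 1), z (e.symm k).1 ≤
          (Finset.univ.erase k).sup (fun k => z (e.symm k).1) := by
        by_contra hcon
        push Not at hcon
        exact hR ⟨_, hcon⟩
      obtain ⟨k, hk⟩ := h1
      set i := (e.symm k).1 with hi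
      have his : i ∈ s := hus (e.symm k).2
      have hle : z i ≤ (s.erase i).sup z := by
        refine hk.trans (Finset.sup_le ?_)
        intro l hl
        apply Finset.le_sup (f := z)
        rw [Finset.mem_erase]
        refine ⟨?_, hus (e.symm l).2⟩
        intro hh
        apply (Finset.mem_erase.1 hl).1
        exact e.symm.injective (Subtype.ext hh)
      have hsup : (s.erase i).sup z = s.sup z := by
        conv_rhs => rw [← Finset.insert_erase his, Finset.sup_insert]
        rw [sup_eq_right.2 hle]
      obtain ⟨v, hv, hv2, hv3⟩ := ih (s.erase i).card
        (by rw [← hn]; exact Finset.card_erase_lt_of_mem his) (s.erase i) rfl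
      exact ⟨v, hv.trans (Finset.erase_subset _ _), hv2, hv3.trans hsup⟩

variable {D : L → L → ℝ} {K E : ℝ}

lemma dist_sup_le (hK : 1 ≤ K) (hE : 0 ≤ E) (h0 : ∀ x, D x x = 0)
    (hsup : ∀ x y x' y', D (x ⊔ y) (x' ⊔ y') ≤ K * (D x x' + D y y') + E)
    (z : ℕ → L) (T : ℝ) (hT : 0 ≤ T) (u : Finset ℕ) (hz : ∀ i ∈ u, D ⊥ (z i) ≤ T) :
    D ⊥ (u.sup z) ≤ (3 * K) ^ u.card * (T + E) := by
  classical
  induction u using Finset.induction_on with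
  | empty => simp [h0]; positivity
  | insert a u ha ih =>
    rw [Finset.sup_insert, Finset.card_insert_of_notMem ha]
    have h1 := hsup ⊥ ⊥ (z a) (u.sup z)
    rw [sup_idem] at h1
    have h2 := ih (fun i hi => hz i (Finset.mem_insert_of_mem hi))
    have h3 := hz a (Finset.mem_insert_self _ _)
    have h4 : (1 : ℝ) ≤ (3 * K) ^ u.card := one_le_pow₀ (by linarith)
    set Q := (3 * K) ^ u.card with hQ
    rw [pow_succ, ← hQ]
    have h5 : D ⊥ (z a) + D ⊥ (u.sup z) ≤ T + Q * (T + E) := by linarith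
    have h6 : K * (D ⊥ (z a) + D ⊥ (u.sup z)) ≤ K * (T + Q * (T + E)) :=
      mul_le_mul_of_nonneg_left h5 (by linarith)
    have h7 : K * E ≥ E := by nlinarith
    have h8 : K * (T + E) ≤ K * (Q * (T + E)) := by
      apply mul_le_mul_of_nonneg_left _ (by linarith)
      nlinarith
    have h9 : 0 ≤ K * (Q * (T + E)) := by positivity
    nlinarith

lemma dist_sum_le (h0 : ∀ x, D x x = 0) (htri : ∀ x y z, D x z ≤ D x y + D y z)
    (v : ℕ → L) (n : ℕ) : D (v 0) (v n) ≤ ∑ j ∈ Finset.range n, D (v j) (v (j + 1)) := by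
  induction n with
  | zero => simp [h0]
  | succ n ih =>
    rw [Finset.sum_range_succ]
    linarith [htri (v 0) (v n) (v (n + 1))]

/-- Two monotone chains: the chain `h` with large jumps cannot be long if it is spanned by a
chain `y` with few small jumps. -/
lemma chain_count (hR : LatRank L η) (hK : 1 ≤ K) (hE : 0 ≤ E) (h0 : ∀ x, D x x = 0)
    (htri : ∀ x y z, D x z ≤ D x y + D y z)
    (hsup : ∀ x y x' y', D (x ⊔ y) (x' ⊔ y') ≤ K * (D x x' + D y y') + E)
    (hinf : ∀ x y x' y', D (x ⊓ y) (x' ⊓ y') ≤ K * (D x x' + D y y') + E)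
    (h y : ℕ → L) (hh : Monotone h) (hy : Monotone y) (A B : ℕ)
    (hy0 : y 0 ≤ h 0) (hyB : h A ≤ y B) (s ε : ℝ) (hε : 0 ≤ ε)
    (hs : ∀ i < A, s ≤ D (h i) (h (i + 1)))
    (hεy : ∀ j < B, D (y j) (y (j + 1)) ≤ ε) :
    A * s ≤ η * (A + B) * (K * (K * ε + E) + E) := by
  classical
  set W := K * (K * ε + E) + E with hW
  have hW0 : 0 ≤ W := by positivity
  set v : ℕ → ℕ → L := fun i j => (h i ⊔ y j) ⊓ h (i + 1) with hv
  set S := (Finset.range A ×ˢ Finset.range B).filter (fun c => v c.1 c.2 ≠ v c.1 (c.2 + 1))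
    with hS
  have hcard : S.card ≤ η * (A + B) := by
    apply cells_card
    · intro c hc
      have := (Finset.mem_filter.1 hc).1
      simpa using this
    · rintro ⟨c, hc, hc2⟩
      apply hR
      refine ⟨fun k => h ((c k).1 + 1) ⊓ y ((c k).2 + 1), ?_⟩
      intro k hle
      have h1 : h ((c k).1 + 1) ⊓ y ((c k).2 + 1) ≤ h (c k).1 ⊔ y (c k).2 := by
        refine hle.trans (Finset.sup_le ?_)
        intro l hl
        rcases lt_or_gt_of_ne (Finset.mem_erase.1 hl).1 with hlk | hlk
        · exact inf_le_of_left_le (le_sup_of_le_left (hh (hc2 l k hlk).1))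
        · exact inf_le_of_right_le (le_sup_of_le_right (hy (hc2 k l hlk).2))
      apply (Finset.mem_filter.1 (hc k)).2
      simp only [hv]
      apply le_antisymm
      · exact inf_le_inf_right _ (sup_le_sup_left (hy (Nat.le_succ _)) _)
      · apply le_inf _ inf_le_right
        rw [inf_sup_right]
        apply sup_le (inf_le_of_left_le le_sup_left)
        rw [inf_comm]
        exact h1
  have hcell : ∀ i j, j < B → D (v i j) (v i (j + 1)) ≤ W := by
    intro i j hj
    have h1 := hinf (h i ⊔ y j) (h (i + 1)) (h i ⊔ y (j + 1)) (h (i + 1))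
    have h2 := hsup (h i) (y j) (h i) (y (j + 1))
    rw [h0] at h1 h2
    have h3 := hεy j hj
    have h4 : K * (0 + D (y j) (y (j + 1))) ≤ K * ε :=
      mul_le_mul_of_nonneg_left (by linarith) (by linarith)
    have h5 : K * (D (h i ⊔ y j) (h i ⊔ y (j + 1)) + 0) ≤ K * (K * ε + E) :=
      mul_le_mul_of_nonneg_left (by linarith) (by linarith)
    linarith
  have hrow : ∀ i < A, s ≤ ∑ j ∈ Finset.range B, D (v i j) (v i (j + 1)) := by
    intro i hi
    have h1 := dist_sum_le h0 htri (v i) B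
    have h2 : v i 0 = h i := by
      simp only [hv]
      rw [sup_eq_left.2 (hy0.trans (hh (Nat.zero_le _))), inf_eq_left.2 (hh (Nat.le_succ _))]
    have h3 : v i B = h (i + 1) := by
      simp only [hv]
      apply inf_eq_right.2
      exact le_sup_of_le_right ((hh (Nat.succ_le_of_lt hi)).trans hyB)
    rw [h2, h3] at h1
    exact (hs i hi).trans h1
  calc (A : ℝ) * s = ∑ i ∈ Finset.range A, s := by simp
    _ ≤ ∑ i ∈ Finset.range A, ∑ j ∈ Finset.range B, D (v i j) (v i (j + 1)) :=
        Finset.sum_le_sum (fun i hi => hrow i (Finset.mem_range.1 hi))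
    _ = ∑ c ∈ Finset.range A ×ˢ Finset.range B, D (v c.1 c.2) (v c.1 (c.2 + 1)) := by
        rw [Finset.sum_product]
    _ = ∑ c ∈ S, D (v c.1 c.2) (v c.1 (c.2 + 1)) := by
        rw [hS, Finset.sum_filter]
        apply Finset.sum_congr rfl
        intro c _
        by_cases hc : v c.1 c.2 = v c.1 (c.2 + 1)
        · simp [hc, h0]
        · simp [hc]
    _ ≤ ∑ c ∈ S, W := by
        apply Finset.sum_le_sum
        intro c hc
        have := (Finset.mem_filter.1 hc).1
        simp only [Finset.mem_product, Finset.mem_range] at this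
        exact hcell _ _ this.2
    _ = S.card * W := by simp
    _ ≤ η * (A + B) * W := by
        apply mul_le_mul_of_nonneg_right _ hW0
        exact_mod_cast hcard

end Lat

/-! ### Approximation of a coarse median interval by a distributive lattice -/

lemma approx_lattice {X : Type*} [MetricSpace X]
    (μ : X → X → X → X) (K : ℝ) (H : ℕ → ℝ) (η : ℕ)
    (hK : 1 ≤ K) (hH : ∀ p : ℕ, 0 ≤ H p)
    (hcm : IsCoarseMedianRank (fun a b : X => dist a b) μ K H η)
    (κ : ℝ) (hκ : 0 ≤ κ) (N : ℕ) :
    ∃ c : ℝ, 0 ≤ c ∧ ∀ (a b : X) (z p : ℕ → X), (∀ k, dist (μ a b (z k)) (z k) ≤ κ) →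
      ∃ (L : Type) (_ : DistribLattice L) (_ : BoundedOrder L) (lam : L → X) (ζ P : ℕ → L),
        LatRank L η ∧
        (∀ x y, dist (lam (x ⊔ y)) (μ (lam x) (lam y) b) ≤ c) ∧
        (∀ x y, dist (lam (x ⊓ y)) (μ a (lam x) (lam y)) ≤ c) ∧
        (∀ x, dist (lam x) (μ a b (lam x)) ≤ c) ∧
        dist a (lam ⊥) ≤ c ∧
        (∀ k < N, dist (z k) (lam (ζ k)) ≤ c) ∧
        (∀ j < N + 1, dist (μ a b (p j)) (lam (P j)) ≤ c) := by
  classical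
  obtain ⟨h1, h2, h3, h4⟩ := hcm
  simp only at h3 h4
  set q := 2 * N + 3 with hq
  set E := H q with hE
  have hE0 : 0 ≤ E := hH q
  have hH0 := hH 0
  have hKE : 0 ≤ K * E := by positivity
  refine ⟨E + 3 * (K * E) + H 0 + κ, by positivity, ?_⟩
  intro a b z p hz
  set A : Finset X := {a, b} ∪ ((Finset.range N).image z ∪ (Finset.range (N + 1)).image p)
    with hA
  have hAc : A.card ≤ q := by
    have e1 := Finset.card_union_le ({a, b} : Finset X)
      ((Finset.range N).image z ∪ (Finset.range (N + 1)).image p)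
    have e2 := Finset.card_union_le ((Finset.range N).image z) ((Finset.range (N + 1)).image p)
    have e3 : ((Finset.range N).image z).card ≤ N := by
      simpa using Finset.card_image_le (s := Finset.range N) (f := z)
    have e4 : ((Finset.range (N + 1)).image p).card ≤ N + 1 := by
      simpa using Finset.card_image_le (s := Finset.range (N + 1)) (f := p)
    have e5 : ({a, b} : Finset X).card ≤ 2 := Finset.card_le_two
    rw [hA]
    omega
  have haA : a ∈ A := by simp [hA]
  have hbA : b ∈ A := by simp [hA]
  have hzA : ∀ k < N, z k ∈ A := fun k hk => by
    rw [hA]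
    exact Finset.mem_union_right _ (Finset.mem_union_left _
      (Finset.mem_image_of_mem _ (Finset.mem_range.2 hk)))
  have hpA : ∀ k < N + 1, p k ∈ A := fun k hk => by
    rw [hA]
    exact Finset.mem_union_right _ (Finset.mem_union_right _
      (Finset.mem_image_of_mem _ (Finset.mem_range.2 hk)))
  obtain ⟨M, _, m, hm, hr, π, lam, hl1, hl2⟩ := h4 q (by omega) A ⟨a, haA⟩ hAc
  set α := π a with hα
  set β := π b with hβ
  have ha := hl2 a haA
  have hb := hl2 b hbA
  rw [← hα, ← hE] at ha
  rw [← hβ, ← hE] at hb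
  have hproj : ∀ (w : X) (x : M) (e : ℝ), dist w (lam x) ≤ e →
      dist (μ a b w) (lam (m α β x)) ≤ E + K * (2 * E + e) + H 0 := by
    intro w x e hw
    have e1 := hl1 α β x
    have e2 := h3 a b w (lam α) (lam β) (lam x)
    have e3 : K * (dist a (lam α) + dist b (lam β) + dist w (lam x)) ≤ K * (2 * E + e) :=
      mul_le_mul_of_nonneg_left (by linarith) (by linarith)
    have e4 := dist_triangle (μ a b w) (μ (lam α) (lam β) (lam x)) (lam (m α β x))
    rw [dist_comm] at e1
    linarith
  refine ⟨{x // m α β x = x}, intLattice hm α β, intBounded hm α β, fun x => lam x.1,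
    fun k => ⟨m α β (π (z k)), med_proj_mem hm _ _ _⟩,
    fun k => ⟨m α β (π (p k)), med_proj_mem hm _ _ _⟩,
    intLattice_rank hm α β hr, ?_, ?_, ?_, ?_, ?_, ?_⟩
  · intro x y
    change dist (lam (m x.1 y.1 β)) (μ (lam x.1) (lam y.1) b) ≤ _
    have e1 := hl1 x.1 y.1 β
    have e2 := h3 (lam x.1) (lam y.1) (lam β) (lam x.1) (lam y.1) b
    rw [dist_self, dist_self, dist_comm (lam β) b] at e2
    have e3 : K * (0 + 0 + dist b (lam β)) ≤ K * E :=
      mul_le_mul_of_nonneg_left (by linarith) (by linarith)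
    have e4 := dist_triangle (lam (m x.1 y.1 β)) (μ (lam x.1) (lam y.1) (lam β))
      (μ (lam x.1) (lam y.1) b)
    linarith
  · intro x y
    change dist (lam (m x.1 y.1 α)) (μ a (lam x.1) (lam y.1)) ≤ _
    have e1 := hl1 x.1 y.1 α
    have e2 := h3 (lam x.1) (lam y.1) (lam α) (lam x.1) (lam y.1) a
    rw [dist_self, dist_self, dist_comm (lam α) a] at e2
    have e3 : K * (0 + 0 + dist a (lam α)) ≤ K * E :=
      mul_le_mul_of_nonneg_left (by linarith) (by linarith)
    have e4 := dist_triangle (lam (m x.1 y.1 α)) (μ (lam x.1) (lam y.1) (lam α))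
      (μ (lam x.1) (lam y.1) a)
    rw [(h2 a (lam x.1) (lam y.1)).2.2.1]
    linarith
  · intro x
    have e1 := hproj (lam x.1) x.1 0 (by rw [dist_self])
    rw [x.2, dist_comm] at e1
    linarith
  · change dist a (lam α) ≤ _
    linarith
  · intro k hk
    have e1 := hproj (z k) (π (z k)) E (hl2 _ (hzA k hk))
    have e2 := dist_triangle (z k) (μ a b (z k)) (lam (m α β (π (z k))))
    have e3 := hz k
    rw [dist_comm] at e3
    simp only
    linarith
  · intro k hk
    have e1 := hproj (p k) (π (p k)) E (hl2 _ (hpA k hk))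
    simp only
    linarith

set_option maxHeartbeats 4000000

/-- Let `(X, ρ, μ)` be a geodesic coarse median space of rank at most
`η` with parameters `K, H` and constants `lam₀, γ` as stated, and set
`L₁(r) = (K+1)r + K·lam₀ + γ + 2H(0)`, `L₂(r,κ) = (K+1)r + κ + H(0)`,
`L₃(r,t) = 3^η K^η r t + r`. Then for every `κ > 0` and `t > 0` there is `r_t > 0` such
that for all `r ≥ r_t` and all `a, b ∈ X` there exists `h ∈ [a,b]_{L₁(r)}` with
`ρ(a,h) ≤ L₃(r,t)` and `B(a, rt) ∩ [a,b]_κ ⊆ [a,h]_{L₂(r,κ)}`. -/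
theorem coarse_median_gate_point {X : Type*} [MetricSpace X]
    (hgeo : IsGeodesicSpace X)
    (μ : X → X → X → X) (K : ℝ) (H : ℕ → ℝ) (η : ℕ)
    (hK : 1 ≤ K) (hH : ∀ p : ℕ, 0 ≤ H p)
    (hcm : IsCoarseMedianRank (fun a b : X => dist a b) μ K H η)
    (lam₀ γ : ℝ) (hlam₀ : 0 ≤ lam₀) (hγ : 0 ≤ γ)
    (hmed : ∀ x y z : X, μ x y z ∈ coarseInterval μ x y lam₀)
    (hM3 : ∀ x y z u v : X,
      dist (μ (μ x y z) u v) (μ (μ x u v) (μ y u v) z) ≤ γ) :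
    ∀ κ : ℝ, 0 < κ → ∀ t : ℝ, 0 < t → ∃ rt : ℝ, 0 < rt ∧
      ∀ r : ℝ, rt ≤ r → ∀ a b : X,
        ∃ h : X, h ∈ coarseInterval μ a b ((K + 1) * r + K * lam₀ + γ + 2 * H 0) ∧
          dist a h ≤ 3 ^ η * K ^ η * r * t + r ∧
          ∀ z : X, dist a z ≤ r * t → z ∈ coarseInterval μ a b κ →
            z ∈ coarseInterval μ a h ((K + 1) * r + κ + H 0) := by
  intro κ hκ t ht
  have hcm' := hcm
  obtain ⟨h1, h2, h3, -⟩ := hcm'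
  simp only at h3
  have hH0 := hH 0
  have hK0 : (0 : ℝ) ≤ K := by linarith
  set Q : ℝ := (3 * K) ^ η with hQ
  have hQ0 : 0 ≤ Q := by positivity
  set C : ℝ := Q * t + 1 with hC
  have hC0 : 0 < C := by positivity
  obtain ⟨M, hM⟩ := exists_nat_gt (4 * η * (K ^ 4 * C))
  have hM0' : (0 : ℝ) < M := lt_of_le_of_lt (by positivity) hM
  have hM0 : 0 < M := by exact_mod_cast hM0'
  obtain ⟨c, hc, happ⟩ := approx_lattice μ K H η hK hH hcm κ hκ.le M
  set E := 2 * c + H 0 with hE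
  have hE0 : 0 ≤ E := by positivity
  set B := c + K * c + H 0 with hB
  have hB0 : 0 ≤ B := by positivity
  set e := (2 * K) ^ M * B with he
  have he0 : 0 ≤ e := by positivity
  have hKe : 0 ≤ K * e := by positivity
  have hKc : 0 ≤ K * c := by positivity
  set e1 := c + K * e + H 0 with he1
  have he10 : 0 ≤ e1 := by positivity
  set F := K * (K * (K * (2 * e1 + H 0) + E) + E) + E with hF
  have hF0 : 0 ≤ F := by positivity
  have hQE : 0 ≤ Q * (2 * c + E) := by positivity
  have hηF : 0 ≤ 4 * η * F := by positivity
  refine ⟨1 + (Q * (2 * c + E) + c + e) + (K * e + H 0 + c + e) +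
    (K * (e + c) + H 0 + 2 * c + E) + 4 * η * F, by positivity, ?_⟩
  intro r hr a b
  have hKec : K * (e + c) = K * e + K * c := by ring
  have hr1 : Q * (2 * c + E) + c + e ≤ r := by linarith
  have hr2 : K * e + H 0 + c + e ≤ r := by linarith
  have hr3 : K * (e + c) + H 0 + 2 * c + E ≤ r := by linarith
  have hr4 : 4 * η * F < r := by linarith
  have hr0 : 0 < r := by linarith
  have hrt : 0 < r * t := by positivity
  clear hr
  by_contra hcon
  have hw : ∀ h : X, ∃ z : X, (dist a z ≤ r * t ∧ dist (μ a b z) z ≤ κ) ∧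
      (h ∈ coarseInterval μ a b ((K + 1) * r + K * lam₀ + γ + 2 * H 0) →
        dist a h ≤ 3 ^ η * K ^ η * r * t + r →
        (K + 1) * r + κ + H 0 < dist (μ a h z) z) := by
    intro h
    by_cases hh : h ∈ coarseInterval μ a b ((K + 1) * r + K * lam₀ + γ + 2 * H 0) ∧
        dist a h ≤ 3 ^ η * K ^ η * r * t + r
    · by_contra hno
      apply hcon
      refine ⟨h, hh.1, hh.2, ?_⟩
      intro z hz1 hz2
      by_contra hz3
      apply hno
      refine ⟨z, ⟨hz1, hz2⟩, fun _ _ => ?_⟩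
      exact not_le.1 hz3
    · refine ⟨a, ⟨by rw [dist_self]; exact hrt.le, ?_⟩, fun u v => absurd ⟨u, v⟩ hh⟩
      rw [(h2 a b a).1, h1, dist_self]
      exact hκ.le
  choose w hw1 hw2 using hw
  set h : ℕ → X := fun n => Nat.rec a (fun _ x => μ (w x) x b) n with hh
  have hzero : h 0 = a := rfl
  have hsucc : ∀ n, h (n + 1) = μ (w (h n)) (h n) b := fun n => rfl
  clear_value h
  set d := dist a (h M) with hd
  obtain ⟨f, hf0, hf1, hf2⟩ := hgeo a (h M)
  rw [← hd] at hf1 hf2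
  have hd0 : 0 ≤ d := dist_nonneg
  set p : ℕ → X := fun j => f (j * (d / M)) with hp
  have hp0 : p 0 = a := by simp [hp, hf0]
  have hpM : p M = h M := by
    simp only [hp]
    rw [mul_div_cancel₀ _ hM0'.ne', hf1]
  have hmem : ∀ j : ℕ, j ≤ M → (j : ℝ) * (d / M) ∈ Set.Icc (0 : ℝ) d := by
    intro j hj
    refine ⟨by positivity, ?_⟩
    have : (j : ℝ) ≤ M := by exact_mod_cast hj
    calc (j : ℝ) * (d / M) ≤ M * (d / M) := mul_le_mul_of_nonneg_right this (by positivity)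
      _ = d := mul_div_cancel₀ _ hM0'.ne'
  have hpd : ∀ j < M, dist (p j) (p (j + 1)) ≤ d / M := by
    intro j hj
    simp only [hp]
    rw [hf2 _ (hmem j hj.le) _ (hmem (j + 1) hj)]
    have : (j : ℝ) * (d / M) - ((j + 1 : ℕ) : ℝ) * (d / M) = -(d / M) := by push_cast; ring
    rw [this, abs_neg, abs_of_nonneg (by positivity)]
  obtain ⟨L, iL, iB, lam, ζ, P, hR, hsup, hinf, hint, hbot, hζ, hP⟩ :=
    happ a b (fun k => w (h k)) p (fun k => (hw1 (h k)).2)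
  set D : L → L → ℝ := fun x y => dist (lam x) (lam y) with hD
  have D0 : ∀ x, D x x = 0 := fun x => dist_self _
  have Dtri : ∀ x y z, D x z ≤ D x y + D y z := fun x y z => dist_triangle _ _ _
  have Dsup : ∀ x y x' y', D (x ⊔ y) (x' ⊔ y') ≤ K * (D x x' + D y y') + E := by
    intro x y x' y'
    have u1 := hsup x y
    have u2 := hsup x' y'
    have u3 := h3 (lam x) (lam y) b (lam x') (lam y') b
    rw [dist_self, add_zero] at u3
    rw [dist_comm] at u2
    have u4 := dist_triangle4 (lam (x ⊔ y)) (μ (lam x) (lam y) b) (μ (lam x') (lam y') b)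
      (lam (x' ⊔ y'))
    simp only [hD]
    linarith
  have Dinf : ∀ x y x' y', D (x ⊓ y) (x' ⊓ y') ≤ K * (D x x' + D y y') + E := by
    intro x y x' y'
    have u1 := hinf x y
    have u2 := hinf x' y'
    have u3 := h3 a (lam x) (lam y) a (lam x') (lam y')
    rw [dist_self, zero_add] at u3
    rw [dist_comm] at u2
    have u4 := dist_triangle4 (lam (x ⊓ y)) (μ a (lam x) (lam y)) (μ a (lam x') (lam y'))
      (lam (x' ⊓ y'))
    simp only [hD]
    linarith
  set g : ℕ → L := fun k => (Finset.range k).sup ζ with hg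
  have hgs : ∀ k, g (k + 1) = ζ k ⊔ g k := by
    intro k
    simp only [hg]
    rw [Finset.range_add_one, Finset.sup_insert]
  -- the lattice joins approximate the iterated joins in `X`
  have herr' : ∀ k ≤ M, dist (h k) (lam (g k)) ≤ (2 * K) ^ k * B := by
    intro k
    induction k with
    | zero =>
      intro _
      simp only [hg, Finset.range_zero, Finset.sup_empty, hzero, pow_zero, one_mul]
      linarith
    | succ k ih =>
      intro hk
      have u1 := ih (by omega)
      have u2 := hsup (ζ k) (g k)
      have u3 := h3 (w (h k)) (h k) b (lam (ζ k)) (lam (g k)) b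
      have u4 := hζ k (by omega)
      rw [dist_self, add_zero] at u3
      rw [hsucc, hgs]
      rw [dist_comm] at u2
      have u5 := dist_triangle (μ (w (h k)) (h k) b) (μ (lam (ζ k)) (lam (g k)) b)
        (lam (ζ k ⊔ g k))
      have u6 : (1 : ℝ) ≤ (2 * K) ^ k := one_le_pow₀ (by linarith)
      have u7 : K * (dist (w (h k)) (lam (ζ k)) + dist (h k) (lam (g k))) ≤
          K * (c + (2 * K) ^ k * B) := mul_le_mul_of_nonneg_left (by linarith) hK0
      have u8 : 1 * B ≤ (K * (2 * K) ^ k) * B :=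
        mul_le_mul_of_nonneg_right (by nlinarith) hB0
      have u9 : (2 * K) ^ (k + 1) * B = 2 * ((K * (2 * K) ^ k) * B) := by ring
      have u10 : K * (c + (2 * K) ^ k * B) = K * c + (K * (2 * K) ^ k) * B := by ring
      linarith
  have herr : ∀ k ≤ M, dist (h k) (lam (g k)) ≤ e := by
    intro k hk
    refine (herr' k hk).trans ?_
    apply mul_le_mul_of_nonneg_right _ hB0
    exact pow_le_pow_right₀ (by linarith) hk
  -- distance bound
  have hdist : ∀ k ≤ M, dist a (h k) ≤ C * r := by
    intro k hk
    obtain ⟨u, hu1, hu2, hu3⟩ := exists_small_sup hR ζ (Finset.range k)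
    have u1 := dist_sup_le (D := D) hK hE0 D0 Dsup ζ (r * t + 2 * c) (by positivity) u (by
      intro i hi
      have hik : i < M := lt_of_lt_of_le (Finset.mem_range.1 (hu1 hi)) hk
      have v1 := hζ i hik
      have v2 := (hw1 (h i)).1
      have v3 := dist_triangle4 (lam ⊥) a (w (h i)) (lam (ζ i))
      rw [dist_comm (lam ⊥) a] at v3
      simp only [hD]
      linarith)
    rw [hu3] at u1
    have u2 : (3 * K) ^ u.card ≤ Q := pow_le_pow_right₀ (by linarith) hu2
    have u3 : (3 * K) ^ u.card * (r * t + 2 * c + E) ≤ Q * (r * t + 2 * c + E) :=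
      mul_le_mul_of_nonneg_right u2 (by positivity)
    have u4 : D ⊥ (g k) ≤ Q * (r * t + 2 * c + E) := u1.trans u3
    have u5 := dist_triangle4 a (lam ⊥) (lam (g k)) (h k)
    have u6 := herr k hk
    rw [dist_comm] at u6
    simp only [hD] at u4
    have u7 : Q * (r * t + 2 * c + E) = Q * t * r + Q * (2 * c + E) := by ring
    have u8 : C * r = Q * t * r + r := by rw [hC]; ring
    linarith
  have hCr : C * r = 3 ^ η * K ^ η * r * t + r := by
    rw [hC, hQ, mul_pow]; ring
  have hproj : ∀ k ≤ M, dist (μ a b (h k)) (lam (g k)) ≤ e1 := by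
    intro k hk
    have u1 := herr k hk
    have u2 := h3 a b (h k) a b (lam (g k))
    rw [dist_self, dist_self, zero_add, zero_add] at u2
    have u3 : K * dist (h k) (lam (g k)) ≤ K * e := mul_le_mul_of_nonneg_left u1 hK0
    have u4 := hint (g k)
    rw [dist_comm] at u4
    have u5 := dist_triangle (μ a b (h k)) (μ a b (lam (g k))) (lam (g k))
    linarith
  have hintv : ∀ k ≤ M, h k ∈
      coarseInterval μ a b ((K + 1) * r + K * lam₀ + γ + 2 * H 0) := by
    intro k hk
    have u1 := herr k hk
    have u2 := hproj k hk
    rw [dist_comm] at u1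
    have u3 := dist_triangle (μ a b (h k)) (lam (g k)) (h k)
    change dist (μ a b (h k)) (h k) ≤ _
    have u4 : 0 ≤ K * r := by positivity
    have u5 : 0 ≤ K * lam₀ := by positivity
    linarith
  -- large jumps
  have hjump : ∀ k < M, r ≤ D (g k) (g (k + 1)) := by
    intro k hk
    have u1 := hw2 (h k) (hintv k hk.le) ((hdist k hk.le).trans hCr.le)
    have u2 := hζ k hk
    have u3 := herr k hk.le
    have u4 := hinf (g k) (ζ k)
    have u5 := h3 a (h k) (w (h k)) a (lam (g k)) (lam (ζ k))
    rw [dist_self, zero_add] at u5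
    have u6 : K * (dist (h k) (lam (g k)) + dist (w (h k)) (lam (ζ k))) ≤ K * (e + c) :=
      mul_le_mul_of_nonneg_left (by linarith) hK0
    have u7 := dist_triangle4 (μ a (h k) (w (h k))) (μ a (lam (g k)) (lam (ζ k)))
      (lam (g k ⊓ ζ k)) (w (h k))
    have u8 := dist_triangle (lam (g k ⊓ ζ k)) (lam (ζ k)) (w (h k))
    rw [dist_comm] at u4
    rw [dist_comm (lam (ζ k))] at u8
    have u9 := Dinf (g k) (ζ k) (g (k + 1)) (ζ k)
    have u10 : g (k + 1) ⊓ ζ k = ζ k := by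
      rw [hgs]
      exact inf_eq_right.2 le_sup_left
    rw [u10, D0, add_zero] at u9
    have u11 : dist (lam (g k ⊓ ζ k)) (lam (ζ k)) = D (g k ⊓ ζ k) (ζ k) := rfl
    have u12 : K * r ≤ K * D (g k) (g (k + 1)) := by linarith
    exact le_of_mul_le_mul_left u12 (by linarith)
  -- the second chain
  set P' : ℕ → L := Function.update (Function.update P 0 ⊥) M (g M) with hP'
  have hP'0 : P' 0 = ⊥ := by
    rw [hP', Function.update_of_ne hM0.ne, Function.update_self]
  have hP'M : P' M = g M := by rw [hP', Function.update_self]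
  have hP'e : ∀ j ≤ M, dist (μ a b (p j)) (lam (P' j)) ≤ e1 := by
    intro j hj
    by_cases hjM : j = M
    · rw [hjM, hP'M, hpM]
      exact hproj M le_rfl
    · by_cases hj0 : j = 0
      · rw [hj0, hP'0, hp0, (h2 a b a).1, h1]
        linarith
      · rw [hP', Function.update_of_ne hjM, Function.update_of_ne hj0]
        have := hP j (by omega)
        linarith
  set y : ℕ → L := fun j => (Finset.range (j + 1)).sup P' with hy
  have hys : ∀ j, y (j + 1) = y j ⊔ P' (j + 1) := by
    intro j
    simp only [hy]
    rw [Finset.range_add_one (n := j + 1), Finset.sup_insert, sup_comm]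
  have hyle : ∀ j, P' j ≤ y j := fun j => Finset.le_sup (f := P') (by simp)
  have hdM : d / M ≤ C * r / M := by
    apply div_le_div_of_nonneg_right _ hM0'.le
    exact hdist M le_rfl
  set ε := K * (2 * e1 + K * (C * r / M) + H 0) + E with hε
  have hε0 : 0 ≤ ε := by positivity
  have hyj : ∀ j < M, D (y j) (y (j + 1)) ≤ ε := by
    intro j hj
    have u1 := Dsup (y j) (P' j) (y j) (P' (j + 1))
    rw [← hys, sup_eq_left.2 (hyle j), D0, zero_add] at u1
    have u2 := hP'e j hj.le
    have u3 := hP'e (j + 1) hj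
    have u4 := h3 a b (p j) a b (p (j + 1))
    rw [dist_self, dist_self, zero_add, zero_add] at u4
    have u5 : K * dist (p j) (p (j + 1)) ≤ K * (C * r / M) :=
      mul_le_mul_of_nonneg_left ((hpd j hj).trans hdM) hK0
    rw [dist_comm] at u2
    have u6 := dist_triangle4 (lam (P' j)) (μ a b (p j)) (μ a b (p (j + 1))) (lam (P' (j + 1)))
    have u7 : K * D (P' j) (P' (j + 1)) ≤ K * (2 * e1 + K * (C * r / M) + H 0) := by
      apply mul_le_mul_of_nonneg_left _ hK0
      simp only [hD]
      linarith
    linarith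
  have hfin := chain_count (D := D) hR hK hE0 D0 Dtri Dsup Dinf g y
    (fun i j hij => Finset.sup_mono (Finset.range_mono hij))
    (fun i j hij => Finset.sup_mono (Finset.range_mono (by omega))) M M
    (by simp [hy, hP'0]) (hP'M ▸ hyle M) r ε hε0 hjump hyj
  have hW : K * (K * ε + E) + E = K ^ 4 * C * r / M + F := by
    rw [hε, hF]; ring
  rw [hW] at hfin
  have v1 : (η : ℝ) * (M + M) * (K ^ 4 * C * r / M + F) =
      2 * η * (K ^ 4 * C) * r + M * (2 * η * F) := by
    field_simp
    ring
  rw [v1] at hfin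
  have v2 : 4 * η * (K ^ 4 * C) * r < M * r := mul_lt_mul_of_pos_right hM hr0
  have v3 : (M : ℝ) * (4 * η * F) < M * r := mul_lt_mul_of_pos_left hr4 hM0'
  linarith
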